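/- Let S = R ∪ B be a bicolored point set in convex position with |R| = |B| ≥ 1 or |R| = |B| + 1 ≥ 2, and let P be a Hamiltonian alternating path on S oriented from its endpoint p to its other endpoint q. Suppose p_1q_1 and p_2q_2 are two crossing edges of P, each written in the direction of traversal of P (so P traverses from p_1 to q_1 and from p_2 to q_2), such that q_1 and p_2 have the same color. Then there exists a Hamiltonian alternating path on S from p to q with strictly fewer crossings than P. -/

import Mathlib

open scoped Classical

noncomputable section

/-- Points of the plane. -/
abbrev Pt := ℝ × ℝ

/-- Orientation determinant of the ordered triple `(a, b, c)`. -/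
def det2 (a b c : Pt) : ℝ :=
  (b.1 - a.1) * (c.2 - a.2) - (b.2 - a.2) * (c.1 - a.1)

/-- Two closed segments cross: some point lies in the relative interior of both. -/
def SegCross (e f : Pt × Pt) : Prop :=
  ∃ x : Pt, x ∈ openSegment ℝ e.1 e.2 ∧ x ∈ openSegment ℝ f.1 f.2

/-- Number of crossings (unordered pairs of crossing edges) among a list of edges. -/
def crossNum (es : List (Pt × Pt)) : ℕ :=
  ((Finset.range es.length ×ˢ Finset.range es.length).filter
    (fun ij => ij.1 < ij.2 ∧
      SegCross (es.getD ij.1 ((0, 0), (0, 0))) (es.getD ij.2 ((0, 0), (0, 0))))).card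

/-- Number of other edges crossing the `i`-th edge of the list. -/
def edgeCrossCount (es : List (Pt × Pt)) (i : ℕ) : ℕ :=
  ((Finset.range es.length).filter (fun j => j ≠ i ∧
      SegCross (es.getD i ((0, 0), (0, 0))) (es.getD j ((0, 0), (0, 0))))).card

/-- Every edge is crossed by at most one other edge. -/
def OnePlane (es : List (Pt × Pt)) : Prop :=
  ∀ i ∈ Finset.range es.length, edgeCrossCount es i ≤ 1

/-- The edges of a path given by its list of vertices. -/
def pathEdges (l : List Pt) : List (Pt × Pt) := l.zip l.tail

/-- The edges of a cycle given by its list of vertices (including the wrap-around edge). -/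
def cycleEdges (l : List Pt) : List (Pt × Pt) := l.zip (l.rotate 1)

/-- An edge joining a point of `R` to a point of `B`. -/
def Bichromatic (R B : Finset Pt) (e : Pt × Pt) : Prop :=
  (e.1 ∈ R ∧ e.2 ∈ B) ∨ (e.1 ∈ B ∧ e.2 ∈ R)

/-- A Hamiltonian alternating path on the bicolored point set `R ∪ B`
with endpoints `p` and `q`. -/
structure HamAltPath (R B : Finset Pt) (p q : Pt) where
  verts : List Pt
  nodup : verts.Nodup
  cover : verts.toFinset = R ∪ B
  head_eq : verts.head? = some p
  last_eq : verts.getLast? = some q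
  alt : ∀ e ∈ pathEdges verts, Bichromatic R B e

/-- A Hamiltonian alternating cycle on the bicolored point set `R ∪ B`. -/
structure HamAltCycle (R B : Finset Pt) where
  verts : List Pt
  nodup : verts.Nodup
  cover : verts.toFinset = R ∪ B
  alt : ∀ e ∈ cycleEdges verts, Bichromatic R B e

/-- A Hamiltonian alternating path with prescribed endpoints is optimum if it has the
minimum number of crossings among all such paths. -/
def OptimumPath (R B : Finset Pt) (p q : Pt) (P : HamAltPath R B p q) : Prop :=
  ∀ Q : HamAltPath R B p q, crossNum (pathEdges P.verts) ≤ crossNum (pathEdges Q.verts)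

/-- No three points of `S` are collinear. -/
def GeneralPosition (S : Finset Pt) : Prop :=
  ∀ p ∈ S, ∀ q ∈ S, ∀ r ∈ S, p ≠ q → p ≠ r → q ≠ r → ¬ Collinear ℝ ({p, q, r} : Set Pt)

/-- Every point of `S` is a vertex (extreme point) of its convex hull. -/
def ConvexPosition (S : Finset Pt) : Prop :=
  ∀ p ∈ S, p ∉ convexHull ℝ ((S.erase p : Finset Pt) : Set Pt)

/-- The points of `S` lying on the boundary of the convex hull of `S`
(i.e. the extreme points of `S`). -/
def hullPts (S : Finset Pt) : Finset Pt :=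
  S.filter fun p => p ∉ convexHull ℝ ((S.erase p : Finset Pt) : Set Pt)

/-- Cyclic successor on `Fin m`. -/
def cycSucc {m : ℕ} (hm : 0 < m) (i : Fin m) : Fin m :=
  ⟨(i.val + 1) % m, Nat.mod_lt _ hm⟩

/-- Cyclic predecessor on `Fin m`. -/
def cycPred {m : ℕ} (hm : 0 < m) (i : Fin m) : Fin m :=
  ⟨(i.val + (m - 1)) % m, Nat.mod_lt _ hm⟩

/-- `pt` lists points in convex position, in clockwise circular order:
every index-increasing triple is clockwise oriented. -/
def CWList {m : ℕ} (pt : Fin m → Pt) : Prop :=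
  Function.Injective pt ∧
    ∀ i j k : Fin m, i < j → j < k → det2 (pt i) (pt j) (pt k) < 0

/-- `pt` is a clockwise listing of the points of `S` on the boundary of `CH(S)`. -/
def IsHullList (S : Finset Pt) {m : ℕ} (pt : Fin m → Pt) : Prop :=
  CWList pt ∧ Finset.univ.image pt = hullPts S

/-- The number of runs of color `A` (with other color `C`) in the cyclic sequence `pt`:
a run starts at an `A`-point whose cyclic predecessor is a `C`-point; a completely
`A`-colored cycle forms a single run. -/
def runCount {m : ℕ} (hm : 0 < m) (A C : Finset Pt) (pt : Fin m → Pt) : ℕ :=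
  if ∀ i : Fin m, pt i ∈ A then 1
  else (Finset.univ.filter fun i : Fin m => pt i ∈ A ∧ pt (cycPred hm i) ∈ C).card

/-- `q` is the counterclockwise radial order of the points of `T` around `r`. -/
def CCWOrder (r : Pt) {k : ℕ} (q : Fin k → Pt) (T : Finset Pt) : Prop :=
  Function.Injective q ∧ Finset.univ.image q = T ∧
    ∀ i j : Fin k, i < j → 0 < det2 r (q i) (q j)

/-- `q` is the clockwise radial order of the points of `T` around `r`. -/
def CWOrder (r : Pt) {k : ℕ} (q : Fin k → Pt) (T : Finset Pt) : Prop :=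
  Function.Injective q ∧ Finset.univ.image q = T ∧
    ∀ i j : Fin k, i < j → det2 r (q i) (q j) < 0

/-- Counting one extra point of color `A` (the center), the initial segment
`q 0, …, q j` contains equally many points of color `A` and of color `C`. -/
def BalancedAt (A C : Finset Pt) {k : ℕ} (q : Fin k → Pt) (j : Fin k) : Prop :=
  1 + (Finset.univ.filter fun i : Fin k => i ≤ j ∧ q i ∈ A).card
    = (Finset.univ.filter fun i : Fin k => i ≤ j ∧ q i ∈ C).card

/-- `j` is the first balanced index of the sequence `q`. -/
def FirstBalanced (A C : Finset Pt) {k : ℕ} (q : Fin k → Pt) (j : Fin k) : Prop :=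
  BalancedAt A C q j ∧ ∀ j' : Fin k, j' < j → ¬ BalancedAt A C q j'

/-- The triple `(R ∪ B, r, b)` is a special configuration (Definition 2.2):
(i) both neighbors of `r` on the hull boundary are red and both neighbors of `b` are
blue; (ii) in the counterclockwise and clockwise radial orders around `r`, the first
balanced point is `b`; (iii) symmetrically around `b`, the first balanced point is `r`. -/
def SpecialConfig (R B : Finset Pt) (r b : Pt) : Prop :=
  r ∈ hullPts (R ∪ B) ∧ b ∈ hullPts (R ∪ B) ∧
  (∀ (m : ℕ) (hm : 0 < m) (pt : Fin m → Pt), IsHullList (R ∪ B) pt →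
    ∀ i : Fin m,
      (pt i = r → pt (cycPred hm i) ∈ R ∧ pt (cycSucc hm i) ∈ R) ∧
      (pt i = b → pt (cycPred hm i) ∈ B ∧ pt (cycSucc hm i) ∈ B)) ∧
  (∀ (k : ℕ) (q : Fin k → Pt),
      (CCWOrder r q ((R ∪ B).erase r) ∨ CWOrder r q ((R ∪ B).erase r)) →
      ∀ j : Fin k, FirstBalanced R B q j → q j = b) ∧
  (∀ (k : ℕ) (q : Fin k → Pt),
      (CCWOrder b q ((R ∪ B).erase b) ∨ CWOrder b q ((R ∪ B).erase b)) →
      ∀ j : Fin k, FirstBalanced B R q j → q j = r)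

/-- The unordered pair `{a, b}` occurs as an edge of the list `es`. -/
def IsEdgeOf (es : List (Pt × Pt)) (a b : Pt) : Prop := (a, b) ∈ es ∨ (b, a) ∈ es

/-- The clockwise cyclic interval of indices from `a` to `b`, inclusive. -/
def cycIdx {m : ℕ} (hm : 0 < m) (a b : Fin m) : Finset (Fin m) :=
  (Finset.range ((b.val + m - a.val) % m + 1)).image
    fun t => (⟨(a.val + t) % m, Nat.mod_lt _ hm⟩ : Fin m)


/-! ### Geometry of segments in convex position -/

lemma segCross_comm {e f : Pt × Pt} : SegCross e f ↔ SegCross f e := by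
  simp only [SegCross, and_comm]

lemma segCross_swap_left {a b : Pt} {f : Pt × Pt} :
    SegCross (a, b) f ↔ SegCross (b, a) f := by
  simp only [SegCross, openSegment_symm ℝ a b]

lemma segCross_swap_right {a b : Pt} {e : Pt × Pt} :
    SegCross e (a, b) ↔ SegCross e (b, a) := by
  simp only [SegCross, openSegment_symm ℝ a b]

/-- `det2 a b` is affine in its last argument. -/
lemma det2_combo (a b c d : Pt) {u v : ℝ} (h : u + v = 1) :
    det2 a b (u • c + v • d) = u * det2 a b c + v * det2 a b d := by
  obtain rfl : v = 1 - u := by linarith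
  simp only [det2, Prod.fst_add, Prod.snd_add, Prod.smul_fst, Prod.smul_snd, smul_eq_mul]
  ring

lemma det2_left (a b : Pt) : det2 a b a = 0 := by simp [det2]

lemma det2_right (a b : Pt) : det2 a b b = 0 := by simp only [det2]; ring

lemma eq_lineMap_of_det2_eq_zero {a b c : Pt} (hab : a ≠ b) (h : det2 a b c = 0) :
    ∃ t : ℝ, c = (1 - t) • a + t • b := by
  simp only [det2] at h
  by_cases h1 : b.1 - a.1 = 0
  · have h2 : b.2 - a.2 ≠ 0 := fun h2 => hab (Prod.ext (by linarith) (by linarith))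
    refine ⟨(c.2 - a.2) / (b.2 - a.2), Prod.ext ?_ ?_⟩
    · have : c.1 - a.1 = 0 := by
        rw [h1, zero_mul, zero_sub, neg_eq_zero] at h
        exact (mul_eq_zero.mp h).resolve_left h2
      simp only [Prod.fst_add, Prod.smul_fst, smul_eq_mul]
      field_simp
      linear_combination (b.2 - a.2) * this - (c.2 - a.2) * h1
    · simp only [Prod.snd_add, Prod.smul_snd, smul_eq_mul]
      field_simp
      ring
  · refine ⟨(c.1 - a.1) / (b.1 - a.1), Prod.ext ?_ ?_⟩
    · simp only [Prod.fst_add, Prod.smul_fst, smul_eq_mul]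
      field_simp
      ring
    · simp only [Prod.snd_add, Prod.smul_snd, smul_eq_mul]
      field_simp
      linear_combination h

/-- A point of a set in convex position is not a convex combination of other points. -/
lemma ConvexPosition.ne_combo {S : Finset Pt} (hS : ConvexPosition S) {x a c d : Pt}
    (hx : x ∈ S) (ha : a ∈ S) (hc : c ∈ S) (hd : d ∈ S) (hax : a ≠ x) (hcx : c ≠ x)
    (hdx : d ≠ x) {y : Pt} (hy : y ∈ segment ℝ c d) : x ∉ segment ℝ a y := by
  intro hxy
  have hmem : ∀ z ∈ S, z ≠ x → z ∈ convexHull ℝ ((S.erase x : Finset Pt) : Set Pt) :=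
    fun z hz hzx => subset_convexHull ℝ _ (by simp [hz, hzx])
  have hconv := convex_convexHull ℝ ((S.erase x : Finset Pt) : Set Pt)
  exact hS x hx (hconv.segment_subset (hmem a ha hax)
    (hconv.segment_subset (hmem c hc hcx) (hmem d hd hdx) hy) hxy)

lemma ConvexPosition.eq_or_eq_of_det2_eq_zero {S : Finset Pt} (hS : ConvexPosition S)
    {a b c : Pt} (ha : a ∈ S) (hb : b ∈ S) (hc : c ∈ S) (hab : a ≠ b)
    (h : det2 a b c = 0) : c = a ∨ c = b := by
  by_contra! hne
  obtain ⟨hca, hcb⟩ := hne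
  obtain ⟨t, ht⟩ := eq_lineMap_of_det2_eq_zero hab h
  rcases lt_or_ge t 0 with h0 | h0
  · refine hS.ne_combo ha hb hc hc hab.symm hca hca (left_mem_segment ℝ c c)
      ⟨-t / (1 - t), 1 / (1 - t), div_nonneg (by linarith) (by linarith),
        div_nonneg (by linarith) (by linarith), ?_, ?_⟩
    · field_simp [show (1 - t) ≠ 0 by linarith]
      ring
    · have h1 : (1 - t) ≠ 0 := by linarith
      subst ht
      ext <;> simp <;> field_simp <;> ring
  · rcases le_or_gt t 1 with h1 | h1
    · exact hS.ne_combo hc ha hb hb hca.symm hcb.symm hcb.symm (left_mem_segment ℝ b b)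
        ⟨1 - t, t, by linarith, h0, by ring, ht.symm⟩
    · refine hS.ne_combo hb ha hc hc hab hcb hcb (left_mem_segment ℝ c c)
        ⟨1 - 1 / t, 1 / t, ?_, by positivity, by ring, ?_⟩
      · rw [sub_nonneg, div_le_one (by linarith)]
        exact h1.le
      · have h1 : t ≠ 0 := by linarith
        subst ht
        ext <;> simp <;> field_simp <;> ring

/-- Distinct crossing edges: the line through the first separates the ends of the second. -/
lemma ConvexPosition.det2_mul_neg {S : Finset Pt} (hS : ConvexPosition S)
    {a b c d : Pt} (ha : a ∈ S) (hb : b ∈ S) (hc : c ∈ S) (hd : d ∈ S) (hab : a ≠ b)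
    (hcd : c ≠ d) (hne : s(a, b) ≠ s(c, d)) (h : SegCross (a, b) (c, d)) :
    det2 a b c * det2 a b d < 0 := by
  obtain ⟨x, ⟨u, v, hu, hv, huv, rfl⟩, ⟨u', v', hu', hv', huv', hx⟩⟩ := h
  have key := congrArg (det2 a b) hx
  simp only at key
  rw [det2_combo _ _ _ _ huv, det2_combo _ _ _ _ huv', det2_left, det2_right, mul_zero,
    mul_zero, add_zero] at key
  have hc0 : det2 a b c ≠ 0 := by
    intro h0
    have hd0 : det2 a b d = 0 := by
      rw [h0, mul_zero, zero_add] at key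
      exact (mul_eq_zero.mp key).resolve_left hv'.ne'
    rcases hS.eq_or_eq_of_det2_eq_zero ha hb hc hab h0 with rfl | rfl <;>
      rcases hS.eq_or_eq_of_det2_eq_zero ha hb hd hab hd0 with rfl | rfl
    · exact hcd rfl
    · exact hne rfl
    · exact hne Sym2.eq_swap
    · exact hcd rfl
  have hd1 : det2 a b d = -(u' / v') * det2 a b c := by
    field_simp
    linarith
  rw [hd1]
  have : 0 < u' / v' := by positivity
  nlinarith [mul_pos this (pow_pos (abs_pos.mpr hc0) 2), sq_abs (det2 a b c)]

/-- If the line through two points separates two others, the edges cross. -/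
lemma ConvexPosition.segCross_of_det2_mul_neg {S : Finset Pt} (hS : ConvexPosition S)
    {a b c d : Pt} (ha : a ∈ S) (hb : b ∈ S) (hc : c ∈ S) (hd : d ∈ S)
    (h : det2 a b c * det2 a b d < 0) : SegCross (a, b) (c, d) := by
  have hc0 : det2 a b c ≠ 0 := left_ne_zero_of_mul h.ne
  have hd0 : det2 a b d ≠ 0 := right_ne_zero_of_mul h.ne
  have hab : a ≠ b := by
    rintro rfl
    exact hc0 (by simp [det2])
  have hca : c ≠ a := by rintro rfl; exact hc0 (det2_left _ _)
  have hcb : c ≠ b := by rintro rfl; exact hc0 (det2_right _ _)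
  have hda : d ≠ a := by rintro rfl; exact hd0 (det2_left _ _)
  have hdb : d ≠ b := by rintro rfl; exact hd0 (det2_right _ _)
  obtain ⟨u, v, hu, hv, huv, h0⟩ : ∃ u v : ℝ, 0 < u ∧ 0 < v ∧ u + v = 1 ∧
      u * det2 a b c + v * det2 a b d = 0 := by
    rcases mul_neg_iff.mp h with ⟨h1, h2⟩ | ⟨h1, h2⟩
    · have h3 : 0 < det2 a b c - det2 a b d := by linarith
      refine ⟨-det2 a b d / (det2 a b c - det2 a b d), det2 a b c / (det2 a b c - det2 a b d),
        div_pos (by linarith) h3, div_pos h1 h3, ?_, ?_⟩ <;> field_simp <;> ring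
    · have h3 : 0 < det2 a b d - det2 a b c := by linarith
      refine ⟨det2 a b d / (det2 a b d - det2 a b c), -det2 a b c / (det2 a b d - det2 a b c),
        div_pos h2 h3, div_pos (by linarith) h3, ?_, ?_⟩ <;> field_simp <;> ring
  rw [← det2_combo _ _ _ _ huv] at h0
  have hy : u • c + v • d ∈ openSegment ℝ c d := ⟨u, v, hu, hv, huv, rfl⟩
  generalize u • c + v • d = y at h0 hy
  have hys := openSegment_subset_segment ℝ c d hy
  obtain ⟨t, ht⟩ := eq_lineMap_of_det2_eq_zero hab h0
  refine ⟨y, ⟨1 - t, t, ?_, ?_, by ring, ht.symm⟩, hy⟩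
  · by_contra! h1
    have ht0 : 0 < t := by linarith
    refine hS.ne_combo hb ha hc hd hab hcb hdb hys
      ⟨1 - 1 / t, 1 / t, ?_, by positivity, by ring, ?_⟩
    · rw [sub_nonneg, div_le_one ht0]
      linarith
    · subst ht
      ext <;> simp <;> field_simp <;> ring
  · by_contra! h1
    have ht0 : 0 < 1 - t := by linarith
    refine hS.ne_combo ha hb hc hd hab.symm hca hda hys
      ⟨-t / (1 - t), 1 / (1 - t), div_nonneg (by linarith) ht0.le, by positivity, ?_, ?_⟩
    · field_simp
      ring
    · subst ht
      ext <;> simp <;> field_simp <;> ring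

/-- Sign-change count for an affine function at the ends of two crossing segments. -/
lemma sign_change_le {A B C D u v u' v' : ℝ} (hu : 0 < u) (hv : 0 < v) (hu' : 0 < u')
    (hv' : 0 < v') (h : u * A + v * B = u' * C + v' * D) :
    (if A * C < 0 then 1 else 0) + (if B * D < 0 then 1 else 0) ≤
      (if A * B < 0 then 1 else 0) + (if C * D < 0 then 1 else (0 : ℕ)) := by
  have scale : ∀ {s t x y : ℝ}, 0 < s → 0 < t → ((s * x) * (t * y) < 0 ↔ x * y < 0) := by
    intro s t x y hs ht
    rw [mul_mul_mul_comm]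
    exact ⟨fun h => neg_of_mul_neg_right h (mul_pos hs ht).le,
      mul_neg_of_pos_of_neg (mul_pos hs ht)⟩
  simp only [← scale (x := A) (y := C) hu hu', ← scale (x := B) (y := D) hv hv',
    ← scale (x := A) (y := B) hu hv, ← scale (x := C) (y := D) hu' hv']
  generalize u * A = A at h ⊢
  generalize v * B = B at h ⊢
  generalize u' * C = C at h ⊢
  generalize v' * D = D at h ⊢
  simp only [mul_neg_iff]
  split_ifs <;> first | omega | (exfalso; grind)

/-! ### Crossings of unordered edges -/

/-- Crossing of unordered edges. -/
def SymCross (z w : Sym2 Pt) : Prop :=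
  ∃ a b c d : Pt, z = s(a, b) ∧ w = s(c, d) ∧ SegCross (a, b) (c, d)

lemma symCross_mk {a b c d : Pt} : SymCross s(a, b) s(c, d) ↔ SegCross (a, b) (c, d) := by
  constructor
  · rintro ⟨a', b', c', d', h1, h2, h⟩
    rcases Sym2.eq_iff.mp h1 with ⟨rfl, rfl⟩ | ⟨rfl, rfl⟩ <;>
      rcases Sym2.eq_iff.mp h2 with ⟨rfl, rfl⟩ | ⟨rfl, rfl⟩
    · exact h
    · exact segCross_swap_right.mp h
    · exact segCross_swap_left.mp h
    · exact segCross_swap_left.mp (segCross_swap_right.mp h)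
  · exact fun h => ⟨a, b, c, d, rfl, rfl, h⟩

lemma symCross_comm {z w : Sym2 Pt} : SymCross z w ↔ SymCross w z := by
  induction z with | _ a b
  induction w with | _ c d
  rw [symCross_mk, symCross_mk, segCross_comm]

/-- Number of edges of a list crossed by a given edge. -/
def crossWith (z : Sym2 Pt) (l : List (Sym2 Pt)) : ℕ :=
  (l.map fun w => if SymCross z w then 1 else 0).sum

/-- Number of crossing pairs in a list of unordered edges. -/
def symCrossNum : List (Sym2 Pt) → ℕ
  | [] => 0
  | z :: l => crossWith z l + symCrossNum l

lemma crossWith_cons (z w : Sym2 Pt) (l : List (Sym2 Pt)) :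
    crossWith z (w :: l) = (if SymCross z w then 1 else 0) + crossWith z l := by
  simp [crossWith]

lemma crossWith_perm (z : Sym2 Pt) {l l' : List (Sym2 Pt)} (h : l.Perm l') :
    crossWith z l = crossWith z l' :=
  (h.map _).sum_eq

lemma symCrossNum_perm {l l' : List (Sym2 Pt)} (h : l.Perm l') :
    symCrossNum l = symCrossNum l' := by
  induction h with
  | nil => rfl
  | cons z h ih => rw [symCrossNum, symCrossNum, ih, crossWith_perm z h]
  | swap z w l =>
    simp only [symCrossNum, crossWith_cons, symCross_comm (z := z) (w := w)]
    ring
  | trans _ _ ih₁ ih₂ => exact ih₁.trans ih₂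

lemma crossNum_cons (e : Pt × Pt) (es : List (Pt × Pt)) :
    crossNum (e :: es) =
      (es.map fun f => if SegCross e f then 1 else 0).sum + crossNum es := by
  have hsum : ∀ l : List (Pt × Pt), crossNum l = ∑ i ∈ Finset.range l.length,
      ∑ j ∈ Finset.range l.length, if i < j ∧ SegCross (l.getD i ((0, 0), (0, 0)))
        (l.getD j ((0, 0), (0, 0))) then 1 else 0 := by
    intro l
    rw [crossNum, Finset.card_filter, Finset.sum_product]
  have hlist : ∀ l : List (Pt × Pt), (l.map fun f => if SegCross e f then 1 else 0).sum =
      ∑ j ∈ Finset.range l.length,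
        if SegCross e (l.getD j ((0, 0), (0, 0))) then 1 else 0 := by
    intro l
    induction l with
    | nil => simp
    | cons f l ih =>
      rw [List.map_cons, List.sum_cons, ih, List.length_cons, Finset.sum_range_succ']
      simp only [List.getD_cons_succ, List.getD_cons_zero]
      rw [add_comm]
  rw [hsum, hsum, hlist, List.length_cons, Finset.sum_range_succ', add_comm]
  simp only [Finset.sum_range_succ', List.getD_cons_succ, List.getD_cons_zero,
    Nat.succ_pos, lt_irrefl, Nat.not_lt_zero, Nat.add_lt_add_iff_right, true_and, false_and,
    if_false, add_zero]

lemma crossNum_eq_symCrossNum (es : List (Pt × Pt)) :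
    crossNum es = symCrossNum (es.map fun e => s(e.1, e.2)) := by
  induction es with
  | nil => simp [crossNum, symCrossNum]
  | cons e es ih =>
    rw [crossNum_cons, ih, List.map_cons, symCrossNum, crossWith, List.map_map]
    congr 3
    funext f
    simp [symCross_mk]

/-! ### Unordered edges of a path -/

/-- The unordered edges of a path. -/
def symEdges (l : List Pt) : List (Sym2 Pt) := (pathEdges l).map fun e => s(e.1, e.2)

lemma pathEdges_cons_cons (a b : Pt) (l : List Pt) :
    pathEdges (a :: b :: l) = (a, b) :: pathEdges (b :: l) := by
  simp [pathEdges]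

lemma symEdges_singleton (a : Pt) : symEdges [a] = [] := by
  simp [symEdges, pathEdges]

lemma symEdges_cons_cons (a b : Pt) (l : List Pt) :
    symEdges (a :: b :: l) = s(a, b) :: symEdges (b :: l) := by
  simp [symEdges, pathEdges_cons_cons]

lemma mem_symEdges {l : List Pt} {a b : Pt} :
    s(a, b) ∈ symEdges l ↔ (a, b) ∈ pathEdges l ∨ (b, a) ∈ pathEdges l := by
  simp only [symEdges, List.mem_map, Sym2.eq_iff]
  constructor
  · rintro ⟨e, h, ⟨rfl, rfl⟩ | ⟨rfl, rfl⟩⟩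
    · exact Or.inl h
    · exact Or.inr h
  · rintro (h | h)
    · exact ⟨(a, b), h, Or.inl ⟨rfl, rfl⟩⟩
    · exact ⟨(b, a), h, Or.inr ⟨rfl, rfl⟩⟩

lemma mem_of_mem_pathEdges {l : List Pt} {e : Pt × Pt} (h : e ∈ pathEdges l) :
    e.1 ∈ l ∧ e.2 ∈ l :=
  ⟨(List.of_mem_zip h).1, List.mem_of_mem_tail (List.of_mem_zip h).2⟩

lemma symEdges_nodup {l : List Pt} (h : l.Nodup) : (symEdges l).Nodup := by
  induction l with
  | nil => simp [symEdges, pathEdges]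
  | cons a l ih =>
    cases l with
    | nil => simp [symEdges_singleton]
    | cons b l =>
      rw [symEdges_cons_cons, List.nodup_cons]
      refine ⟨fun hm => (List.nodup_cons.mp h).1 ?_, ih (List.nodup_cons.mp h).2⟩
      rcases mem_symEdges.mp hm with hm | hm
      · exact (mem_of_mem_pathEdges hm).1
      · exact (mem_of_mem_pathEdges hm).2

lemma symEdges_append (A C : List Pt) (a b : Pt) :
    symEdges (A ++ a :: b :: C) = symEdges (A ++ [a]) ++ s(a, b) :: symEdges (b :: C) := by
  induction A with
  | nil => simp [symEdges_cons_cons, symEdges_singleton]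
  | cons x A ih =>
    cases A with
    | nil => simp [symEdges_cons_cons, symEdges_singleton]
    | cons y A =>
      simp only [List.cons_append, symEdges_cons_cons] at ih ⊢
      rw [ih]

lemma symEdges_reverse (l : List Pt) : (symEdges l.reverse).Perm (symEdges l) := by
  induction l with
  | nil => simp
  | cons a l ih =>
    cases l with
    | nil => simp
    | cons b l =>
      have h : (a :: b :: l).reverse = l.reverse ++ b :: a :: [] := by simp
      rw [h, symEdges_append, symEdges_singleton, symEdges_cons_cons, Sym2.eq_swap]
      rw [List.reverse_cons] at ih
      exact (List.perm_append_singleton _ _).trans (ih.cons _)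

lemma exists_append_of_mem_pathEdges {l : List Pt} {a b : Pt} (h : (a, b) ∈ pathEdges l) :
    ∃ A C, l = A ++ a :: b :: C := by
  induction l with
  | nil => simp [pathEdges] at h
  | cons x l ih =>
    cases l with
    | nil => simp [pathEdges] at h
    | cons y l =>
      rw [pathEdges_cons_cons, List.mem_cons] at h
      rcases h with h | h
      · obtain ⟨rfl, rfl⟩ := Prod.mk.inj h
        exact ⟨[], l, rfl⟩
      · obtain ⟨A, C, hA⟩ := ih h
        exact ⟨x :: A, C, by rw [hA, List.cons_append]⟩

/-- Two edges of a path without common vertex, in one of the two possible orders. -/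
lemma exists_append_of_two_mem {l : List Pt} {a b c d : Pt} (h1 : (a, b) ∈ pathEdges l)
    (h2 : (c, d) ∈ pathEdges l) (hne : (a, b) ≠ (c, d)) (hbc : b ≠ c) (hda : d ≠ a) :
    (∃ X M Z, l = X ++ a :: (b :: (M ++ c :: d :: Z))) ∨
      ∃ X M Z, l = X ++ c :: (d :: (M ++ a :: b :: Z)) := by
  induction l with
  | nil => simp [pathEdges] at h1
  | cons x l ih =>
    cases l with
    | nil => simp [pathEdges] at h1
    | cons y l =>
      rw [pathEdges_cons_cons, List.mem_cons] at h1 h2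
      have tail : ∀ {u v w z : Pt}, (u, v) = (x, y) → (w, z) ∈ pathEdges (y :: l) → v ≠ w →
          ∃ X M Z, x :: y :: l = X ++ u :: (v :: (M ++ w :: z :: Z)) := by
        intro u v w z huv hwz hvw
        obtain ⟨rfl, rfl⟩ := Prod.mk.inj huv
        obtain ⟨A, C, hA⟩ := exists_append_of_mem_pathEdges hwz
        cases A with
        | nil => exact absurd (List.cons.inj hA).1 hvw
        | cons t A =>
          obtain ⟨rfl, hl⟩ := List.cons.inj hA
          exact ⟨[], A, C, by simp [hl]⟩
      rcases h1 with h1 | h1 <;> rcases h2 with h2 | h2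
      · exact absurd (h1.trans h2.symm) hne
      · exact Or.inl (tail h1 h2 hbc)
      · exact Or.inr (tail h2 h1 hda)
      · rcases ih h1 h2 with ⟨X, M, Z, h⟩ | ⟨X, M, Z, h⟩
        · exact Or.inl ⟨x :: X, M, Z, by rw [h, List.cons_append]⟩
        · exact Or.inr ⟨x :: X, M, Z, by rw [h, List.cons_append]⟩

/-- Reversing the subpath between two edges exchanges them for two others. -/
lemma exists_exchange (X M Z : List Pt) (a b c d : Pt) :
    ∃ (l' : List Pt) (E : List (Sym2 Pt)),
      l'.Perm (X ++ a :: (b :: (M ++ c :: d :: Z))) ∧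
      l'.head? = (X ++ a :: (b :: (M ++ c :: d :: Z))).head? ∧
      l'.getLast? = (X ++ a :: (b :: (M ++ c :: d :: Z))).getLast? ∧
      (symEdges (X ++ a :: (b :: (M ++ c :: d :: Z)))).Perm (s(a, b) :: s(c, d) :: E) ∧
      (symEdges l').Perm (s(a, c) :: s(b, d) :: E) := by
  refine ⟨X ++ a :: (c :: (M.reverse ++ b :: d :: Z)),
    symEdges (X ++ [a]) ++ (symEdges (b :: (M ++ [c])) ++ symEdges (d :: Z)), ?_, ?_, ?_, ?_, ?_⟩
  · refine (List.Perm.cons a ?_).append_left X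
    have h : (c :: (M.reverse ++ [b])).Perm (b :: (M ++ [c])) := by
      have := List.reverse_perm (b :: (M ++ [c]))
      simpa using this
    simpa using h.append_right (d :: Z)
  · cases X <;> simp
  · simp [List.getLast?_append, List.getLast?_cons]
  · rw [symEdges_append, ← List.cons_append, symEdges_append, List.cons_append]
    rw [← Multiset.coe_eq_coe]
    simp only [← Multiset.coe_add, ← Multiset.cons_coe, ← Multiset.singleton_add]
    abel
  · rw [symEdges_append, ← List.cons_append, symEdges_append, List.cons_append]
    have h : (symEdges (c :: (M.reverse ++ [b]))).Perm (symEdges (b :: (M ++ [c]))) := by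
      have := symEdges_reverse (b :: (M ++ [c]))
      simpa using this
    rw [← Multiset.coe_eq_coe] at h ⊢
    simp only [← Multiset.coe_add, ← Multiset.cons_coe, ← Multiset.singleton_add]
    rw [h]
    abel

/-- Exchanging two crossing edges for two opposite sides of their quadrilateral. -/
lemma ConvexPosition.symCrossNum_exchange_lt {S : Finset Pt} (hS : ConvexPosition S)
    {a b c d : Pt} (ha : a ∈ S) (hb : b ∈ S) (hc : c ∈ S) (hd : d ∈ S)
    (hac : a ≠ c) (hbd : b ≠ d)
    (hcross : SegCross (a, b) (c, d)) {E : List (Sym2 Pt)}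
    (hE : ∀ x y, s(x, y) ∈ E → x ∈ S ∧ y ∈ S ∧ x ≠ y)
    (hnd : (s(a, c) :: s(b, d) :: E).Nodup) :
    symCrossNum (s(a, c) :: s(b, d) :: E) < symCrossNum (s(a, b) :: s(c, d) :: E) := by
  have key : ∀ x y,
      (if det2 x y a * det2 x y c < 0 then 1 else 0) +
        (if det2 x y b * det2 x y d < 0 then 1 else 0) ≤
      (if det2 x y a * det2 x y b < 0 then 1 else 0) +
        (if det2 x y c * det2 x y d < 0 then 1 else (0 : ℕ)) := by
    intro x y
    obtain ⟨w, ⟨u, v, hu, hv, huv, hw⟩, ⟨u', v', hu', hv', huv', hw'⟩⟩ := hcross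
    have h := congrArg (det2 x y) (hw.trans hw'.symm)
    simp only at h
    rw [det2_combo _ _ _ _ huv, det2_combo _ _ _ _ huv'] at h
    exact sign_change_le hu hv hu' hv' h
  simp only [List.nodup_cons, List.mem_cons, not_or] at hnd
  obtain ⟨⟨hne, hacE⟩, hbdE, -⟩ := hnd
  have hsides : ¬ SymCross s(a, c) s(b, d) := by
    rw [symCross_mk]
    intro h
    have h1 := hS.det2_mul_neg ha hc hb hd hac hbd hne h
    have h2 := key a c
    simp [det2_left, det2_right, h1] at h2
  have hdiag : SymCross s(a, b) s(c, d) := symCross_mk.mpr hcross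
  have hstep : ∀ w ∈ E, (if SymCross s(a, c) w then 1 else 0) +
      (if SymCross s(b, d) w then 1 else 0) ≤ (if SymCross s(a, b) w then 1 else 0) +
      (if SymCross s(c, d) w then 1 else (0 : ℕ)) := by
    intro w hw
    induction w with | _ x y
    obtain ⟨hx, hy, hxy⟩ := hE x y hw
    have new : ∀ {u v : Pt}, u ∈ S → v ∈ S → u ≠ v → s(u, v) ∉ E →
        SymCross s(u, v) s(x, y) → det2 x y u * det2 x y v < 0 := by
      intro u v hu hv huv huvE h
      refine hS.det2_mul_neg hx hy hu hv hxy huv ?_ (segCross_comm.mp (symCross_mk.mp h))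
      intro heq
      exact huvE (heq ▸ hw)
    have old : ∀ {u v : Pt}, u ∈ S → v ∈ S → det2 x y u * det2 x y v < 0 →
        SymCross s(u, v) s(x, y) := fun hu hv h =>
      symCross_mk.mpr (segCross_comm.mp (hS.segCross_of_det2_mul_neg hx hy hu hv h))
    have mono : ∀ {p q : Prop}, (p → q) → (if p then 1 else 0) ≤ if q then 1 else (0 : ℕ) := by
      intro p q h
      by_cases hp : p
      · simp [hp, h hp]
      · simp [hp]
    exact (add_le_add (mono (new ha hc hac hacE)) (mono (new hb hd hbd hbdE))).trans
      ((key x y).trans (add_le_add (mono (old ha hb)) (mono (old hc hd))))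
  have hsum : crossWith s(a, c) E + crossWith s(b, d) E ≤
      crossWith s(a, b) E + crossWith s(c, d) E := by
    simp only [crossWith, ← List.sum_map_add]
    exact List.sum_le_sum hstep
  simp only [symCrossNum, crossWith_cons, if_neg hsides, if_pos hdiag]
  omega

lemma bichromatic_swap {R B : Finset Pt} {a b : Pt} (h : Bichromatic R B (a, b)) :
    Bichromatic R B (b, a) := by
  rcases h with ⟨h1, h2⟩ | ⟨h1, h2⟩
  · exact Or.inr ⟨h2, h1⟩
  · exact Or.inl ⟨h2, h1⟩

/-- Corollary 3.9: let `S = R ∪ B` be in convex position with `|R| = |B| ≥ 1` or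
`|R| = |B| + 1 ≥ 2`, and let `P` be a Hamiltonian alternating path on `S` oriented from
`p` to `q` containing two crossing edges `p₁q₁` and `p₂q₂` (each written in the direction
of traversal) such that `q₁` and `p₂` have the same color.  Then there is a Hamiltonian
alternating path on `S` from `p` to `q` with strictly fewer crossings than `P`. -/
theorem stmt14 (R B : Finset Pt) (hdisj : Disjoint R B)
    (hconv : ConvexPosition (R ∪ B))
    (hcard : (R.card = B.card ∧ 1 ≤ R.card) ∨ (R.card = B.card + 1 ∧ 2 ≤ R.card))
    (p q : Pt) (P : HamAltPath R B p q)
    (p₁ q₁ p₂ q₂ : Pt)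
    (h1 : (p₁, q₁) ∈ pathEdges P.verts) (h2 : (p₂, q₂) ∈ pathEdges P.verts)
    (hcross : SegCross (p₁, q₁) (p₂, q₂))
    (hcolor : (q₁ ∈ R ∧ p₂ ∈ R) ∨ (q₁ ∈ B ∧ p₂ ∈ B)) :
    ∃ Q : HamAltPath R B p q,
      crossNum (pathEdges Q.verts) < crossNum (pathEdges P.verts) := by
  obtain ⟨l, hnd, hcov, hhead, hlast, halt⟩ := P
  simp only at h1 h2 ⊢
  have hb1 := halt _ h1
  have hb2 := halt _ h2
  have hmem : ∀ x, x ∈ l ↔ x ∈ R ∪ B := fun x => by rw [← hcov, List.mem_toFinset]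
  have hRB : ∀ x, x ∈ R → x ∉ B := fun _ hx => Finset.disjoint_left.mp hdisj hx
  have hedge_ne : ∀ {x y : Pt}, Bichromatic R B (x, y) → x ≠ y := by
    rintro x y (⟨hx, hy⟩ | ⟨hx, hy⟩) rfl
    · exact hRB _ hx hy
    · exact hRB _ hy hx
  have hpp : Bichromatic R B (p₁, p₂) := by
    simp only [Bichromatic] at hb1 ⊢
    grind
  have hqq : Bichromatic R B (q₁, q₂) := by
    simp only [Bichromatic] at hb2 ⊢
    grind
  have hp1 := (hmem _).mp (mem_of_mem_pathEdges h1).1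
  have hq1 := (hmem _).mp (mem_of_mem_pathEdges h1).2
  have hp2 := (hmem _).mp (mem_of_mem_pathEdges h2).1
  have hq2 := (hmem _).mp (mem_of_mem_pathEdges h2).2
  simp only at hp1 hq1 hp2 hq2
  have hsne : s(p₁, q₁) ≠ s(p₂, q₂) := by
    intro heq
    obtain ⟨rfl, rfl⟩ := Prod.mk.inj (List.inj_on_of_nodup_map (symEdges_nodup hnd) h1 h2 heq)
    simp only [Bichromatic] at hb1
    grind
  have hsep := hconv.det2_mul_neg hp1 hq1 hp2 hq2 (hedge_ne hb1) (hedge_ne hb2) hsne hcross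
  have hqp : q₁ ≠ p₂ := by
    rintro rfl
    simp [det2_right] at hsep
  have hqp' : q₂ ≠ p₁ := by
    rintro rfl
    simp [det2_left] at hsep
  obtain ⟨l', E, hperm, hhead', hlast', hE, hE'⟩ : ∃ (l' : List Pt) (E : List (Sym2 Pt)),
      l'.Perm l ∧ l'.head? = l.head? ∧ l'.getLast? = l.getLast? ∧
      (symEdges l).Perm (s(p₁, q₁) :: s(p₂, q₂) :: E) ∧
      (symEdges l').Perm (s(p₁, p₂) :: s(q₁, q₂) :: E) := by
    rcases exists_append_of_two_mem h1 h2 (fun h => hsne (by rw [Sym2.eq_iff]; simp_all))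
      hqp hqp' with ⟨X, M, Z, rfl⟩ | ⟨X, M, Z, rfl⟩
    · exact exists_exchange X M Z p₁ q₁ p₂ q₂
    · obtain ⟨l', E, hperm, hh, hl, hE, hE'⟩ := exists_exchange X M Z p₂ q₂ p₁ q₁
      refine ⟨l', E, hperm, hh, hl, hE.trans (List.Perm.swap _ _ _), ?_⟩
      rwa [Sym2.eq_swap (a := p₁), Sym2.eq_swap (a := q₁)]
  have haltE : ∀ x y, s(x, y) ∈ E → Bichromatic R B (x, y) := by
    intro x y h
    have hxy : s(x, y) ∈ symEdges l := hE.mem_iff.mpr (by simp [h])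
    rcases mem_symEdges.mp hxy with hxy | hxy
    · exact halt _ hxy
    · exact bichromatic_swap (halt _ hxy)
  have hnd' : l'.Nodup := hperm.nodup_iff.mpr hnd
  refine ⟨⟨l', hnd', ?_, hhead'.trans hhead, hlast'.trans hlast, ?_⟩, ?_⟩
  · rw [← hcov]
    exact List.toFinset_eq_of_perm _ _ hperm
  · rintro ⟨x, y⟩ hxy
    have h := hE'.mem_iff.mp (mem_symEdges.mpr (Or.inl hxy))
    simp only [List.mem_cons, Sym2.eq_iff] at h
    rcases h with (⟨rfl, rfl⟩ | ⟨rfl, rfl⟩) | (⟨rfl, rfl⟩ | ⟨rfl, rfl⟩) | h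
    · exact hpp
    · exact bichromatic_swap hpp
    · exact hqq
    · exact bichromatic_swap hqq
    · exact haltE x y h
  · simp only [crossNum_eq_symCrossNum]
    change symCrossNum (symEdges l') < symCrossNum (symEdges l)
    rw [symCrossNum_perm hE, symCrossNum_perm hE']
    refine hconv.symCrossNum_exchange_lt hp1 hq1 hp2 hq2 (hedge_ne hpp) (hedge_ne hqq) hcross
      (fun x y h => ⟨?_, ?_, hedge_ne (haltE x y h)⟩) (hE'.nodup_iff.mp (symEdges_nodup hnd'))
    · have := haltE x y h
      simp only [Bichromatic, Finset.mem_union] at this ⊢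
      tauto
    · have := haltE x y h
      simp only [Bichromatic, Finset.mem_union] at this ⊢
      tauto
end
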